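/- Projector relations: for every integer ℓ ≥ 1 and every q ∈ ℂ \ {0} with q^{2k} ≠ 1 for 1 ≤ k ≤ ℓ, the operators P^{(ℓ)} and P̃^{(ℓ)} on (ℂ²)^{⊗ℓ} satisfy (P^{(ℓ)})² = P^{(ℓ)}, (P̃^{(ℓ)})² = P̃^{(ℓ)}, P^{(ℓ)} P̃^{(ℓ)} = P^{(ℓ)}, and P̃^{(ℓ)} P^{(ℓ)} = P̃^{(ℓ)}. -/

import Mathlib

open scoped BigOperators

/-- The q-integer [k]_q = (q^k − q^{−k})/(q − q^{−1}). -/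
noncomputable def qInt (q : ℂ) (k : ℕ) : ℂ := (q ^ k - q⁻¹ ^ k) / (q - q⁻¹)

/-- The q-factorial [k]_q!. -/
noncomputable def qFact (q : ℂ) : ℕ → ℂ
  | 0 => 1
  | k + 1 => qInt q (k + 1) * qFact q k

/-- The q-binomial coefficient [l ¦ n]_q. -/
noncomputable def qBinom (q : ℂ) (l n : ℕ) : ℂ := qFact q l / (qFact q (l - n) * qFact q n)

/-- The set of down-spin positions of a basis state of (ℂ²)^{⊗l}. -/
def downs {l : ℕ} (σ : Fin l → Fin 2) : Finset (Fin l) := Finset.univ.filter fun j => σ j = 1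

/-- The 1-based sum i₁ + ⋯ + i_n of down-spin positions. -/
def idxSum {l : ℕ} (σ : Fin l → Fin 2) : ℤ := ∑ j ∈ downs σ, ((j : ℕ) + 1 : ℤ)

/-- The vector ||l,n⟩ in coordinates: its coefficient on the basis state σ. -/
noncomputable def ketV (q : ℂ) (l n : ℕ) : (Fin l → Fin 2) → ℂ := fun σ =>
  if (downs σ).card = n then
    q ^ (idxSum σ - (n : ℤ) * (l : ℤ) + ((n * (n - 1) / 2 : ℕ) : ℤ)) else 0

/-- The covector ⟨l,n|| in coordinates. -/
noncomputable def braV (q : ℂ) (l n : ℕ) : (Fin l → Fin 2) → ℂ := fun σ =>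
  (qBinom q l n)⁻¹ * q ^ ((n : ℤ) * ((l : ℤ) - (n : ℤ))) *
    (if (downs σ).card = n then
      q ^ (idxSum σ - (n : ℤ) * (l : ℤ) + ((n * (n - 1) / 2 : ℕ) : ℤ)) else 0)

/-- The conjugate vector ||l,n⟩~ in coordinates. -/
noncomputable def ketTilde (q : ℂ) (l n : ℕ) : (Fin l → Fin 2) → ℂ := fun σ =>
  qBinom q l n * q ^ (-(n : ℤ) * ((l : ℤ) - (n : ℤ))) / (Nat.choose l n : ℂ) *
    (if (downs σ).card = n then
      q ^ (-idxSum σ + (n : ℤ) * (l : ℤ) - ((n * (n - 1) / 2 : ℕ) : ℤ)) else 0)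

/-- The projector P^{(l)} = Σ_n ||l,n⟩⟨l,n||. -/
noncomputable def projP (q : ℂ) (l : ℕ) : Matrix (Fin l → Fin 2) (Fin l → Fin 2) ℂ :=
  ∑ n ∈ Finset.range (l + 1), Matrix.vecMulVec (ketV q l n) (braV q l n)

/-- The projector P̃^{(l)} = Σ_n ||l,n⟩~ ⟨l,n||. -/
noncomputable def projPt (q : ℂ) (l : ℕ) : Matrix (Fin l → Fin 2) (Fin l → Fin 2) ℂ :=
  ∑ n ∈ Finset.range (l + 1), Matrix.vecMulVec (ketTilde q l n) (braV q l n)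

/-- The generating function `∑ x ^ (i₁ + ⋯ + i_n)` over basis states with `n` down spins. -/
noncomputable def downSum (x : ℂ) (l n : ℕ) : ℂ :=
  ∑ σ : Fin l → Fin 2, if (downs σ).card = n then x ^ idxSum σ else 0

theorem card_downs_eq_sum {l : ℕ} (σ : Fin l → Fin 2) :
    (downs σ).card = ∑ j, if σ j = 1 then 1 else 0 :=
  Finset.card_filter _ _

theorem idxSum_eq_sum {l : ℕ} (σ : Fin l → Fin 2) :
    idxSum σ = ∑ j : Fin l, if σ j = 1 then ((j : ℕ) + 1 : ℤ) else 0 :=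
  Finset.sum_filter _ _

theorem card_downs_snoc {l : ℕ} (σ : Fin l → Fin 2) (s : Fin 2) :
    (downs (Fin.snoc σ s : Fin (l + 1) → Fin 2)).card =
      (downs σ).card + if s = 1 then 1 else 0 := by
  simp [card_downs_eq_sum, Fin.sum_univ_castSucc, -Finset.sum_boole]

theorem idxSum_snoc {l : ℕ} (σ : Fin l → Fin 2) (s : Fin 2) :
    idxSum (Fin.snoc σ s : Fin (l + 1) → Fin 2) =
      idxSum σ + if s = 1 then ((l : ℤ) + 1) else 0 := by
  simp [idxSum_eq_sum, Fin.sum_univ_castSucc]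

theorem sum_snoc {l : ℕ} (f : (Fin (l + 1) → Fin 2) → ℂ) :
    ∑ σ, f σ = ∑ σ : Fin l → Fin 2, (f (Fin.snoc σ 0) + f (Fin.snoc σ 1)) := by
  rw [← (Fin.snocEquiv fun _ : Fin (l + 1) => Fin 2).sum_comp, Fintype.sum_prod_type_right]
  simp [Fin.sum_univ_two, Fin.snocEquiv]

theorem downSum_succ_succ {x : ℂ} (hx : x ≠ 0) (l n : ℕ) :
    downSum x (l + 1) (n + 1) = downSum x l (n + 1) + x ^ (l + 1) * downSum x l n := by
  unfold downSum
  rw [sum_snoc, Finset.sum_add_distrib, Finset.mul_sum]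
  congr 1
  · simp [card_downs_snoc, idxSum_snoc]
  · refine Finset.sum_congr rfl fun σ _ => ?_
    simp only [card_downs_snoc, idxSum_snoc, if_true, add_left_inj, mul_ite, mul_zero]
    split_ifs
    · rw [zpow_add₀ hx, mul_comm]
      norm_cast
    · rfl

theorem downSum_zero_right (x : ℂ) (l : ℕ) : downSum x l 0 = 1 := by
  induction l with
  | zero => simp [downSum, downs, idxSum]
  | succ l ih =>
    rw [← ih]
    unfold downSum
    rw [sum_snoc]
    simp [card_downs_snoc, idxSum_snoc]

theorem downSum_eq_zero_of_lt (x : ℂ) {l n : ℕ} (h : l < n) : downSum x l n = 0 := by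
  refine Finset.sum_eq_zero fun σ _ => if_neg fun hc => ?_
  have := Finset.card_le_univ (downs σ)
  rw [Fintype.card_fin] at this
  omega

theorem downSum_one (l n : ℕ) : downSum 1 l n = Nat.choose l n := by
  induction l generalizing n with
  | zero =>
    cases n with
    | zero => simp [downSum_zero_right]
    | succ n => simp [downSum_eq_zero_of_lt]
  | succ l ih =>
    cases n with
    | zero => simp [downSum_zero_right]
    | succ n =>
      rw [downSum_succ_succ one_ne_zero, ih, ih, Nat.choose_succ_succ]
      push_cast
      ring

theorem qInt_add {q : ℂ} (hq : q ≠ 0) (a b : ℕ) :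
    qInt q a + q ^ (a + b) * qInt q b = q ^ b * qInt q (a + b) := by
  unfold qInt
  have ha : q ^ a * q⁻¹ ^ a = 1 := by rw [← mul_pow, mul_inv_cancel₀ hq, one_pow]
  have hb : q ^ b * q⁻¹ ^ b = 1 := by rw [← mul_pow, mul_inv_cancel₀ hq, one_pow]
  rw [mul_div_assoc', mul_div_assoc', ← add_div]
  congr 1
  rw [pow_add, pow_add]
  linear_combination (q⁻¹ ^ a - q ^ a) * hb

/-- The q-binomial theorem in the form of a sum over down-spin configurations. -/
theorem downSum_sq_mul_qFact {q : ℂ} (hq : q ≠ 0) (a b : ℕ) :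
    downSum (q ^ 2) (a + b) b * (qFact q a * qFact q b) =
      q ^ (b * (a + b + 1)) * qFact q (a + b) := by
  have hq2 : q ^ 2 ≠ 0 := pow_ne_zero _ hq
  induction b generalizing a with
  | zero => simp [downSum_zero_right, qFact]
  | succ b ihb =>
    induction a with
    | zero =>
      have h := ihb 0
      rw [zero_add] at h ⊢
      simp only [qFact, one_mul] at h ⊢
      rw [downSum_succ_succ hq2, downSum_eq_zero_of_lt _ (Nat.lt_succ_self b)]
      linear_combination (q ^ 2) ^ (b + 1) * qInt q (b + 1) * h
    | succ a iha =>
      have h := ihb (a + 1)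
      have hint := qInt_add hq (a + 1) (b + 1)
      have e₁ : a + 1 + (b + 1) = a + b + 1 + 1 := by ring
      have e₂ : a + 1 + b = a + b + 1 := by ring
      have e₃ : a + (b + 1) = a + b + 1 := by ring
      rw [e₁] at hint ⊢
      rw [e₂] at h
      rw [e₃] at iha
      rw [downSum_succ_succ hq2]
      simp only [qFact] at h iha hint ⊢
      linear_combination qInt q (a + 1) * iha + (q ^ 2) ^ (a + b + 1 + 1) * qInt q (b + 1) * h +
        q ^ ((b + 1) * (a + b + 1 + 1)) * (qInt q (a + b + 1) * qFact q (a + b)) * hint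

theorem qInt_ne_zero {q : ℂ} (hq : q ≠ 0) {k : ℕ} (h1 : q ^ 2 ≠ 1) (hk : q ^ (2 * k) ≠ 1) :
    qInt q k ≠ 0 := by
  refine div_ne_zero (fun h => hk ?_) fun h => h1 ?_
  · have hi : q ^ k * q⁻¹ ^ k = 1 := by rw [← mul_pow, mul_inv_cancel₀ hq, one_pow]
    linear_combination q ^ k * h + hi
  · linear_combination q * h + mul_inv_cancel₀ hq

theorem qFact_ne_zero {q : ℂ} (hq : q ≠ 0) {l : ℕ}
    (hroot : ∀ k : ℕ, 1 ≤ k → k ≤ l → q ^ (2 * k) ≠ 1) {k : ℕ} (hk : k ≤ l) :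
    qFact q k ≠ 0 := by
  induction k with
  | zero => simp [qFact]
  | succ k ih =>
    exact mul_ne_zero
      (qInt_ne_zero hq (hroot 1 le_rfl (by omega)) (hroot _ (by omega) hk)) (ih (by omega))

theorem downSum_sq {q : ℂ} (hq : q ≠ 0) {l : ℕ}
    (hroot : ∀ k : ℕ, 1 ≤ k → k ≤ l → q ^ (2 * k) ≠ 1) {n : ℕ} (hn : n ≤ l) :
    downSum (q ^ 2) l n = q ^ (n * (l + 1)) * qBinom q l n := by
  have h := downSum_sq_mul_qFact hq (l - n) n
  rw [Nat.sub_add_cancel hn] at h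
  rw [qBinom, mul_div_assoc', ← h, mul_div_assoc, div_self, mul_one]
  exact mul_ne_zero (qFact_ne_zero hq hroot (Nat.sub_le _ _)) (qFact_ne_zero hq hroot hn)

theorem qBinom_ne_zero {q : ℂ} (hq : q ≠ 0) {l : ℕ}
    (hroot : ∀ k : ℕ, 1 ≤ k → k ≤ l → q ^ (2 * k) ≠ 1) {n : ℕ} (hn : n ≤ l) :
    qBinom q l n ≠ 0 :=
  div_ne_zero (qFact_ne_zero hq hroot le_rfl)
    (mul_ne_zero (qFact_ne_zero hq hroot (Nat.sub_le _ _)) (qFact_ne_zero hq hroot hn))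

theorem two_mul_triangle (n : ℕ) : 2 * ((n * (n - 1) / 2 : ℕ) : ℤ) = n * (n - 1) := by
  have h : 2 * (n * (n - 1) / 2) = n * (n - 1) :=
    Nat.mul_div_cancel' (Nat.even_mul_pred_self n).two_dvd
  cases n with
  | zero => simp
  | succ n =>
    have h' : ((2 * ((n + 1) * (n + 1 - 1) / 2) : ℕ) : ℤ) = ((n + 1) * (n + 1 - 1) : ℕ) := by
      rw [h]
    rw [Nat.cast_mul, Nat.cast_mul (n + 1)] at h'
    simpa using h'

theorem braV_dotProduct_ketV {q : ℂ} (hq : q ≠ 0) {l : ℕ}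
    (hroot : ∀ k : ℕ, 1 ≤ k → k ≤ l → q ^ (2 * k) ≠ 1) {m n : ℕ} (hm : m ≤ l) :
    braV q l m ⬝ᵥ ketV q l n = if m = n then 1 else 0 := by
  split_ifs with hmn
  · subst hmn
    have hb := qBinom_ne_zero hq hroot hm
    have key : braV q l m ⬝ᵥ ketV q l m =
        (qBinom q l m)⁻¹ * q ^ (-((m * (l + 1) : ℕ) : ℤ)) * downSum (q ^ 2) l m := by
      rw [dotProduct, downSum, Finset.mul_sum]
      refine Finset.sum_congr rfl fun σ _ => ?_
      simp only [braV, ketV]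
      split_ifs
      · rw [← zpow_natCast q 2, ← zpow_mul, mul_assoc, mul_assoc, mul_assoc, ← zpow_add₀ hq,
          ← zpow_add₀ hq, ← zpow_add₀ hq]
        congr 2
        simp only [Nat.cast_mul, Nat.cast_add, Nat.cast_one, Nat.cast_ofNat]
        linear_combination two_mul_triangle m
      · simp
    rw [key, downSum_sq hq hroot hm, ← zpow_natCast, zpow_neg]
    have := zpow_ne_zero ((m * (l + 1) : ℕ) : ℤ) hq
    field_simp
  · refine Finset.sum_eq_zero fun σ _ => ?_
    simp only [braV, ketV]
    split_ifs <;> first | omega | simp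

theorem braV_dotProduct_ketTilde {q : ℂ} (hq : q ≠ 0) {l : ℕ}
    (hroot : ∀ k : ℕ, 1 ≤ k → k ≤ l → q ^ (2 * k) ≠ 1) {m n : ℕ} (hm : m ≤ l) :
    braV q l m ⬝ᵥ ketTilde q l n = if m = n then 1 else 0 := by
  split_ifs with hmn
  · subst hmn
    have hb := qBinom_ne_zero hq hroot hm
    have hc : (Nat.choose l m : ℂ) ≠ 0 := Nat.cast_ne_zero.mpr (Nat.choose_pos hm).ne'
    have key : braV q l m ⬝ᵥ ketTilde q l m = (Nat.choose l m : ℂ)⁻¹ * downSum 1 l m := by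
      rw [dotProduct, downSum, Finset.mul_sum]
      refine Finset.sum_congr rfl fun σ _ => ?_
      simp only [braV, ketTilde]
      split_ifs
      · rw [neg_mul, zpow_neg, one_zpow, show -idxSum σ + (m : ℤ) * l - ((m * (m - 1) / 2 : ℕ) : ℤ)
          = -(idxSum σ - m * l + ((m * (m - 1) / 2 : ℕ) : ℤ)) by ring, zpow_neg]
        have h₁ := zpow_ne_zero ((m : ℤ) * (l - m)) hq
        have h₂ := zpow_ne_zero (idxSum σ - m * l + ((m * (m - 1) / 2 : ℕ) : ℤ)) hq
        generalize q ^ ((m : ℤ) * (l - m)) = u at *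
        generalize q ^ (idxSum σ - m * l + ((m * (m - 1) / 2 : ℕ) : ℤ)) = v at *
        field_simp
      · simp
    rw [key, downSum_one, inv_mul_cancel₀ hc]
  · refine Finset.sum_eq_zero fun σ _ => ?_
    simp only [braV, ketTilde]
    split_ifs <;> first | omega | simp

theorem sum_vecMulVec_mul_sum_vecMulVec {ι : Type*} [Fintype ι] {N : ℕ} (u v w b : ℕ → ι → ℂ)
    (h : ∀ m < N, ∀ n < N, v m ⬝ᵥ w n = if m = n then 1 else 0) :
    (∑ m ∈ Finset.range N, Matrix.vecMulVec (u m) (v m)) *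
      (∑ n ∈ Finset.range N, Matrix.vecMulVec (w n) (b n)) =
      ∑ n ∈ Finset.range N, Matrix.vecMulVec (u n) (b n) := by
  rw [Finset.sum_mul]
  refine Finset.sum_congr rfl fun m hm => ?_
  rw [Finset.mul_sum, Finset.sum_eq_single_of_mem m hm]
  · rw [Matrix.vecMulVec_mul_vecMulVec, h m (Finset.mem_range.mp hm) m (Finset.mem_range.mp hm)]
    simp
  · intro n hn hnm
    rw [Matrix.vecMulVec_mul_vecMulVec, h m (Finset.mem_range.mp hm) n (Finset.mem_range.mp hn),
      if_neg hnm.symm]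
    simp

/-- Projector relations: P² = P, P̃² = P̃, P P̃ = P, P̃ P = P̃. -/
theorem stmt7 (l : ℕ) (hl : 1 ≤ l) (q : ℂ) (hq0 : q ≠ 0)
    (hroot : ∀ k : ℕ, 1 ≤ k → k ≤ l → q ^ (2 * k) ≠ 1) :
    projP q l * projP q l = projP q l ∧
    projPt q l * projPt q l = projPt q l ∧
    projP q l * projPt q l = projP q l ∧
    projPt q l * projP q l = projPt q l := by
  have hk : ∀ m < l + 1, ∀ n < l + 1, braV q l m ⬝ᵥ ketV q l n = if m = n then 1 else 0 :=
    fun m hm n _ => braV_dotProduct_ketV hq0 hroot (Nat.lt_succ_iff.mp hm)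
  have ht : ∀ m < l + 1, ∀ n < l + 1, braV q l m ⬝ᵥ ketTilde q l n = if m = n then 1 else 0 :=
    fun m hm n _ => braV_dotProduct_ketTilde hq0 hroot (Nat.lt_succ_iff.mp hm)
  exact ⟨sum_vecMulVec_mul_sum_vecMulVec _ _ _ _ hk, sum_vecMulVec_mul_sum_vecMulVec _ _ _ _ ht,
    sum_vecMulVec_mul_sum_vecMulVec _ _ _ _ ht, sum_vecMulVec_mul_sum_vecMulVec _ _ _ _ hk⟩
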